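/- If X_1, …, X_k are simplicial complexes on the same vertex set V, then the rational Leray number of their intersection satisfies L(⋂_{j=1}^k X_j) ≤ Σ_{j=1}^k L(X_j). -/

import Mathlib

open Classical in
/-- A (possibly abstract) simplicial complex: a set of finsets closed under taking subsets. -/
def IsComplex {V : Type*} (X : Set (Finset V)) : Prop := ∀ s ∈ X, ∀ t ⊆ s, t ∈ X

/-- Ordered `n`-tuples of vertices spanning a simplex of `X` (repetitions allowed). -/
def Tup {V : Type*} [DecidableEq V] (X : Set (Finset V)) (n : ℕ) : Type _ :=
  {σ : Fin n → V // Finset.image σ Finset.univ ∈ X}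

/-- Rational ordered simplicial chains on tuples of `n` vertices. -/
abbrev Chains {V : Type*} [DecidableEq V] (X : Set (Finset V)) (n : ℕ) := Tup X n →₀ ℚ

open Classical in
noncomputable def gen {V : Type*} [DecidableEq V] (X : Set (Finset V)) {n : ℕ}
    (τ : Fin n → V) : Chains X n :=
  if h : Finset.image τ Finset.univ ∈ X then Finsupp.single ⟨τ, h⟩ 1 else 0

/-- The simplicial boundary map. -/
noncomputable def bdry {V : Type*} [DecidableEq V] (X : Set (Finset V)) (n : ℕ) :
    Chains X (n + 1) →ₗ[ℚ] Chains X n :=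
  Finsupp.lsum ℚ fun σ => LinearMap.toSpanSingleton ℚ (Chains X n)
    (∑ i : Fin (n + 1), ((-1 : ℚ) ^ (i : ℕ)) • gen X (σ.1 ∘ i.succAbove))

/-- Reduced rational homology `H̃_i(X;ℚ)` (chains on `i+1` vertices correspond to
`i`-dimensional simplices; tuples with `0` vertices give the augmentation). -/
noncomputable abbrev reducedHomology {V : Type*} [DecidableEq V] (X : Set (Finset V)) (i : ℕ) :=
  LinearMap.ker (bdry X i) ⧸
    Submodule.comap (LinearMap.ker (bdry X i)).subtype (LinearMap.range (bdry X (i + 1)))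

/-- `H̃_i(X;ℚ) = 0`. -/
def HomologyVanishes {V : Type*} [DecidableEq V] (X : Set (Finset V)) (i : ℕ) : Prop :=
  ∀ x : reducedHomology X i, x = 0

/-- The induced subcomplex on a vertex subset. -/
def induced {V : Type*} (X : Set (Finset V)) (S : Finset V) : Set (Finset V) :=
  {s ∈ X | s ⊆ S}

/-- The rational Leray number `L(X)`. -/
noncomputable def lerayNumber {V : Type*} [DecidableEq V] (X : Set (Finset V)) : ℕ :=
  sInf {d | ∀ S : Finset V, ∀ i, d ≤ i → HomologyVanishes (induced X S) i}

section LerayAux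
open TensorProduct

set_option linter.unusedSectionVars false

variable {V : Type*}

/-- Total chains on lists of vertices. -/
abbrev LC (V : Type*) := List V →₀ ℚ

noncomputable def sg (l : List V) : LC V := Finsupp.single l 1

noncomputable def lcons (v : V) : LC V →ₗ[ℚ] LC V := Finsupp.lmapDomain ℚ ℚ (List.cons v)

noncomputable def dL : List V → LC V
  | [] => 0
  | v :: l => sg l - lcons v (dL l)

noncomputable def dd : LC V →ₗ[ℚ] LC V := Finsupp.linearCombination ℚ dL

theorem lc_ext {M : Type*} [AddCommMonoid M] [Module ℚ M] {f g : LC V →ₗ[ℚ] M}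
    (h : ∀ l, f (sg l) = g (sg l)) : f = g := by
  apply Finsupp.lhom_ext'
  intro l
  ext
  simpa [sg] using h l

theorem lc_ext_apply {M : Type*} [AddCommMonoid M] [Module ℚ M] {f g : LC V →ₗ[ℚ] M}
    (h : ∀ l, f (sg l) = g (sg l)) (c : LC V) : f c = g c := by
  rw [lc_ext h]

theorem lin_sg {M : Type*} [AddCommMonoid M] [Module ℚ M] (f : List V → M) (l : List V) :
    Finsupp.linearCombination ℚ f (sg l) = f l := by
  simp [sg]

theorem lcons_sg (v : V) (l : List V) : lcons v (sg l) = sg (v :: l) := by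
  simp [lcons, sg, Finsupp.lmapDomain_apply, Finsupp.mapDomain_single]

theorem dd_sg (l : List V) : dd (sg l) = dL l := lin_sg _ _

theorem dd_nil : dd (sg ([] : List V)) = 0 := by rw [dd_sg]; rfl

theorem dd_cons (v : V) (c : LC V) : dd (lcons v c) = c - lcons v (dd c) := by
  have := lc_ext_apply (f := dd ∘ₗ lcons v) (g := LinearMap.id - lcons v ∘ₗ dd) (by
    intro l
    simp only [LinearMap.comp_apply, lcons_sg, LinearMap.sub_apply, LinearMap.id_apply, dd_sg]
    rfl) c
  simpa using this

theorem dd_dd (c : LC V) : dd (dd c) = 0 := by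
  have := lc_ext_apply (f := dd ∘ₗ dd) (g := (0 : LC V →ₗ[ℚ] LC V)) (by
    intro l
    induction l with
    | nil => simp [dd_nil]
    | cons v l ih =>
      simp only [LinearMap.comp_apply, LinearMap.zero_apply] at ih ⊢
      rw [← lcons_sg, dd_cons, map_sub, dd_cons, ih]; simp) c
  simpa using this

noncomputable def eps : LC V →ₗ[ℚ] LC V :=
  Finsupp.linearCombination ℚ (fun l => ((-1 : ℚ) ^ l.length) • sg l)

theorem eps_sg (l : List V) : eps (sg l) = ((-1 : ℚ) ^ l.length) • sg l := lin_sg _ _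

theorem eps_cons (v : V) (c : LC V) : eps (lcons v c) = - lcons v (eps c) := by
  have := lc_ext_apply (f := eps ∘ₗ lcons v) (g := - (lcons v ∘ₗ eps)) (by
    intro l
    simp only [LinearMap.comp_apply, lcons_sg, LinearMap.neg_apply, eps_sg, map_smul]
    simp [pow_succ]) c
  simpa using this

theorem eps_eps (c : LC V) : eps (eps c) = c := by
  have := lc_ext_apply (f := eps ∘ₗ eps) (g := (LinearMap.id : LC V →ₗ[ℚ] LC V)) (by
    intro l
    simp only [LinearMap.comp_apply, eps_sg, map_smul, smul_smul, LinearMap.id_apply]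
    rw [← mul_pow]; simp) c
  simpa using this

theorem dd_eps (c : LC V) : dd (eps c) = - eps (dd c) := by
  have := lc_ext_apply (f := dd ∘ₗ eps) (g := - (eps ∘ₗ (dd : LC V →ₗ[ℚ] LC V))) (by
    intro l
    induction l with
    | nil => simp [dd_nil, eps_sg]
    | cons v l ih =>
      simp only [LinearMap.comp_apply, LinearMap.neg_apply] at ih ⊢
      rw [← lcons_sg, eps_cons, dd_cons, map_sub, map_neg, dd_cons, eps_cons, ih]
      simp) c
  simpa using this

/-! Supports -/

theorem supp_le {s : Set (List V)} {p : Submodule ℚ (LC V)} (h : ∀ l ∈ s, sg l ∈ p) :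
    Finsupp.supported ℚ ℚ s ≤ p := by
  rw [Finsupp.supported_eq_span_single, Submodule.span_le]
  rintro _ ⟨l, hl, rfl⟩
  exact h l hl

theorem sg_mem {s : Set (List V)} {l : List V} (h : l ∈ s) :
    sg l ∈ Finsupp.supported ℚ ℚ s := Finsupp.single_mem_supported ℚ 1 h

variable [DecidableEq V]

/-- Chains of a complex, all degrees. -/
noncomputable def CZ (Z : Set (Finset V)) : Submodule ℚ (LC V) :=
  Finsupp.supported ℚ ℚ {l | l.toFinset ∈ Z}

/-- Chains of a complex on lists of length `n`. -/
noncomputable def CN (Z : Set (Finset V)) (n : ℕ) : Submodule ℚ (LC V) :=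
  Finsupp.supported ℚ ℚ {l | l.toFinset ∈ Z ∧ l.length = n}

theorem CN_le_CZ (Z : Set (Finset V)) (n : ℕ) : CN Z n ≤ CZ Z :=
  Finsupp.supported_mono (fun _ h => h.1)

theorem CZ_mono {Z W : Set (Finset V)} (h : Z ⊆ W) : CZ Z ≤ CZ W :=
  Finsupp.supported_mono (fun _ hl => h hl)

theorem CN_mono {Z W : Set (Finset V)} (h : Z ⊆ W) (n : ℕ) : CN Z n ≤ CN W n :=
  Finsupp.supported_mono (fun _ hl => ⟨h hl.1, hl.2⟩)

theorem lcons_CN {Z W : Set (Finset V)} {v : V} (h : ∀ E ∈ Z, insert v E ∈ W) {n : ℕ} {c : LC V}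
    (hc : c ∈ CN Z n) : lcons v c ∈ CN W (n + 1) := by
  have : CN Z n ≤ (CN W (n + 1)).comap (lcons v) := by
    apply supp_le
    rintro l ⟨h1, h2⟩
    rw [Submodule.mem_comap, lcons_sg]
    apply sg_mem
    simp only [Set.mem_ofPred_eq, List.toFinset_cons, List.length_cons, h2, and_true]
    exact h _ h1
  exact this hc

theorem lcons_CZ {Z W : Set (Finset V)} {v : V} (h : ∀ E ∈ Z, insert v E ∈ W) {c : LC V}
    (hc : c ∈ CZ Z) : lcons v c ∈ CZ W := by
  have : CZ Z ≤ (CZ W).comap (lcons v) := by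
    apply supp_le
    intro l h1
    rw [Submodule.mem_comap, lcons_sg]
    apply sg_mem
    simp only [Set.mem_ofPred_eq, List.toFinset_cons]
    exact h _ h1
  exact this hc

theorem dL_mem (l : List V) (n : ℕ) (h : l.length = n + 1) :
    dL l ∈ CN {E | E ⊆ l.toFinset} n := by
  induction n generalizing l with
  | zero =>
    match l, h with
    | [v], _ => 
      simp only [dL, map_zero, sub_zero]
      apply sg_mem; simp
  | succ n ih =>
    match l, h with
    | v :: l, h =>
      have h' : l.length = n + 1 := by simpa using h
      simp only [dL]
      apply Submodule.sub_mem
      · apply sg_mem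
        simp [h']
      · apply lcons_CN _ (ih l h')
        intro E hE
        simp only [Set.mem_ofPred_eq, List.toFinset_cons] at *
        exact Finset.insert_subset_insert _ hE

theorem dd_CN {Z : Set (Finset V)} (hZ : IsComplex Z) {n : ℕ} {c : LC V} (hc : c ∈ CN Z (n + 1)) :
    dd c ∈ CN Z n := by
  have : CN Z (n + 1) ≤ (CN Z n).comap dd := by
    apply supp_le
    rintro l ⟨h1, h2⟩
    rw [Submodule.mem_comap, dd_sg]
    exact CN_mono (fun E hE => hZ _ h1 _ hE) n (dL_mem l n h2)
  exact this hc

theorem dd_CN_zero {Z : Set (Finset V)} {c : LC V} (hc : c ∈ CN Z 0) : dd c = 0 := by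
  have : CN Z 0 ≤ LinearMap.ker dd := by
    apply supp_le
    rintro l ⟨h1, h2⟩
    rw [List.length_eq_zero_iff] at h2
    subst h2
    exact dd_nil
  exact this hc

theorem dd_CZ {Z : Set (Finset V)} (hZ : IsComplex Z) {c : LC V} (hc : c ∈ CZ Z) :
    dd c ∈ CZ Z := by
  have : CZ Z ≤ (CZ Z).comap dd := by
    apply supp_le
    intro l h1
    rw [Submodule.mem_comap]
    match h : l.length with
    | 0 =>
      rw [List.length_eq_zero_iff] at h
      subst h
      rw [dd_nil]; exact zero_mem _
    | n + 1 => exact CN_le_CZ Z n (dd_CN hZ (sg_mem ⟨h1, h⟩))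
  exact this hc

theorem eps_CZ {Z : Set (Finset V)} {c : LC V} (hc : c ∈ CZ Z) :
    eps c ∈ CZ Z := by
  have : CZ Z ≤ (CZ Z).comap eps := by
    apply supp_le
    intro l h1
    rw [Submodule.mem_comap, eps_sg]
    exact Submodule.smul_mem _ _ (sg_mem h1)
  exact this hc

/-- length projection -/
noncomputable def lproj (n : ℕ) : LC V →ₗ[ℚ] LC V :=
  Finsupp.linearCombination ℚ (fun l => if l.length = n then sg l else 0)

theorem lproj_sg (n : ℕ) (l : List V) : lproj n (sg l) = if l.length = n then sg l else 0 :=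
  lin_sg _ _

theorem lproj_CN_eq {Z : Set (Finset V)} {n : ℕ} {c : LC V} (hc : c ∈ CN Z n) :
    lproj n c = c := by
  have : CN Z n ≤ LinearMap.eqLocus (lproj n) LinearMap.id := by
    apply supp_le
    rintro l ⟨h1, h2⟩
    simp [LinearMap.mem_eqLocus, lproj_sg, h2]
  exact this hc

theorem lproj_CN_ne {Z : Set (Finset V)} {n m : ℕ} (h : m ≠ n) {c : LC V} (hc : c ∈ CN Z m) :
    lproj n c = 0 := by
  have : CN Z m ≤ LinearMap.ker (lproj n) := by
    apply supp_le
    rintro l ⟨h1, h2⟩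
    simp [lproj_sg, h2, h]
  exact this hc

theorem lproj_CZ {Z : Set (Finset V)} {n : ℕ} {c : LC V} (hc : c ∈ CZ Z) :
    lproj n c ∈ CN Z n := by
  have : CZ Z ≤ (CN Z n).comap (lproj n) := by
    apply supp_le
    intro l h1
    rw [Submodule.mem_comap, lproj_sg]
    split_ifs with h
    · exact sg_mem ⟨h1, h⟩
    · exact zero_mem _
  exact this hc

theorem lproj_dd (n : ℕ) (c : LC V) : dd (lproj (n + 1) c) = lproj n (dd c) := by
  refine lc_ext_apply (f := dd ∘ₗ lproj (n + 1)) (g := lproj n ∘ₗ dd) ?_ c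
  intro l
  simp only [LinearMap.comp_apply, lproj_sg]
  match h : l.length with
  | 0 =>
    rw [List.length_eq_zero_iff] at h
    subst h
    simp [dd_nil]
  | m + 1 =>
    have h1 : dd (sg l) ∈ CN {E | E ⊆ l.toFinset} m := by rw [dd_sg]; exact dL_mem l m h
    by_cases hm : m = n
    · subst hm
      rw [lproj_CN_eq h1]; simp
    · rw [lproj_CN_ne hm h1]; simp [hm]

/-- Vanishing of homology (on lists of length `n`). -/
def Van (Z : Set (Finset V)) (n : ℕ) : Prop :=
  ∀ z ∈ CN Z n, dd z = 0 → ∃ w ∈ CN Z (n + 1), dd w = z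

theorem van_of_CZ {Z : Set (Finset V)} {n : ℕ}
    (h : ∀ z ∈ CN Z n, dd z = 0 → ∃ w ∈ CZ Z, dd w = z) : Van Z n := by
  intro z hz hdz
  obtain ⟨w, hw, rfl⟩ := h z hz hdz
  exact ⟨lproj (n + 1) w, lproj_CZ hw, by rw [lproj_dd, lproj_CN_eq hz]⟩

theorem van_cone {Z : Set (Finset V)} {v : V} (h : ∀ E ∈ Z, insert v E ∈ Z) (n : ℕ) : Van Z n := by
  intro z hz hdz
  exact ⟨lcons v z, lcons_CN h hz, by rw [dd_cons, hdz]; simp⟩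

theorem CN_union (P Q : Set (Finset V)) (n : ℕ) : CN (P ∪ Q) n = CN P n ⊔ CN Q n := by
  unfold CN
  rw [← Finsupp.supported_union]
  congr 1
  ext l
  simp only [Set.mem_ofPred_eq, Set.mem_union]
  tauto

theorem CN_inter (P Q : Set (Finset V)) (n : ℕ) : CN (P ∩ Q) n = CN P n ⊓ CN Q n := by
  unfold CN
  rw [← Finsupp.supported_inter]
  congr 1
  ext l
  simp only [Set.mem_ofPred_eq, Set.mem_inter_iff]
  tauto

theorem isComplex_inter {P Q : Set (Finset V)} (hP : IsComplex P) (hQ : IsComplex Q) :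
    IsComplex (P ∩ Q) := fun s hs t ht => ⟨hP s hs.1 t ht, hQ s hs.2 t ht⟩

theorem mv1 {P Q : Set (Finset V)} (hP : IsComplex P) (hQ : IsComplex Q) {n : ℕ}
    (hU : Van (P ∪ Q) n) (hI : Van (P ∩ Q) n) : Van P n := by
  intro z hz hdz
  obtain ⟨w, hw, hdw⟩ := hU z (CN_mono Set.subset_union_left n hz) hdz
  rw [CN_union, Submodule.mem_sup] at hw
  obtain ⟨p, hp, q, hq, rfl⟩ := hw
  rw [map_add] at hdw
  have h1 : dd q ∈ CN (P ∩ Q) n := by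
    rw [CN_inter]
    refine ⟨?_, dd_CN hQ hq⟩
    have : dd q = z - dd p := by rw [← hdw]; abel
    rw [this]
    exact Submodule.sub_mem _ hz (dd_CN hP hp)
  obtain ⟨u, hu, hdu⟩ := hI _ h1 (dd_dd _)
  refine ⟨p + u, Submodule.add_mem _ hp (CN_mono Set.inter_subset_left _ hu), ?_⟩
  rw [map_add, hdu, hdw]

theorem mv2 {P Q : Set (Finset V)} (hP : IsComplex P) (hQ : IsComplex Q) {n : ℕ}
    (hU : Van (P ∪ Q) (n + 1)) (h1 : Van P n) (h2 : Van Q n) : Van (P ∩ Q) n := by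
  intro z hz hdz
  obtain ⟨p, hp, hdp⟩ := h1 z (CN_mono Set.inter_subset_left n hz) hdz
  obtain ⟨q, hq, hdq⟩ := h2 z (CN_mono Set.inter_subset_right n hz) hdz
  obtain ⟨w, hw, hdw⟩ := hU (p - q) (Submodule.sub_mem _ (CN_mono Set.subset_union_left _ hp)
    (CN_mono Set.subset_union_right _ hq)) (by rw [map_sub, hdp, hdq, sub_self])
  rw [CN_union, Submodule.mem_sup] at hw
  obtain ⟨a, ha, b, hb, rfl⟩ := hw
  rw [map_add] at hdw
  refine ⟨p - dd a, ?_, by rw [map_sub, hdp, dd_dd, sub_zero]⟩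
  rw [CN_inter]
  refine ⟨Submodule.sub_mem _ hp (dd_CN hP ha), ?_⟩
  have : p - dd a = q + dd b := by
    rw [sub_eq_iff_eq_add, add_assoc, add_comm (dd b), hdw]; abel
  rw [this]
  exact Submodule.add_mem _ hq (dd_CN hQ hb)

theorem mv3 {P Q : Set (Finset V)} (hP : IsComplex P) (hQ : IsComplex Q) {n : ℕ}
    (h1 : Van P (n + 1)) (h2 : Van Q (n + 1)) (hI : Van (P ∩ Q) n) : Van (P ∪ Q) (n + 1) := by
  intro z hz hdz
  rw [CN_union, Submodule.mem_sup] at hz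
  obtain ⟨p, hp, q, hq, rfl⟩ := hz
  rw [map_add] at hdz
  have e : dd p = - dd q := eq_neg_of_add_eq_zero_left hdz
  have h3 : dd p ∈ CN (P ∩ Q) n := by
    rw [CN_inter]
    refine ⟨dd_CN hP hp, ?_⟩
    rw [e]
    exact Submodule.neg_mem _ (dd_CN hQ hq)
  obtain ⟨u, hu, hdu⟩ := hI _ h3 (dd_dd _)
  obtain ⟨a, ha, hda⟩ := h1 (p - u) (Submodule.sub_mem _ hp (CN_mono Set.inter_subset_left _ hu))
    (by rw [map_sub, hdu, sub_self])
  obtain ⟨b, hb, hdb⟩ := h2 (q + u) (Submodule.add_mem _ hq (CN_mono Set.inter_subset_right _ hu))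
    (by rw [map_add, hdu, e]; abel)
  refine ⟨a + b, Submodule.add_mem _ (CN_mono Set.subset_union_left _ ha)
    (CN_mono Set.subset_union_right _ hb), ?_⟩
  rw [map_add, hda, hdb]; abel

/-! Vanishing in large degrees -/

theorem van_large (S : Finset V) : ∀ (Z : Set (Finset V)), IsComplex Z → (∀ E ∈ Z, E ⊆ S) →
    ∀ n, S.card < n → Van Z n := by
  induction S using Finset.induction_on with
  | empty =>
    intro Z hZ hS n hn z hz _
    refine ⟨0, zero_mem _, ?_⟩
    have : CN Z n ≤ ⊥ := by
      apply supp_le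
      rintro l ⟨h1, h2⟩
      exfalso
      have := hS _ h1
      rw [Finset.subset_empty, List.toFinset_eq_empty_iff] at this
      subst this
      simp at h2 hn
      omega
    have := this hz
    rw [Submodule.mem_bot] at this
    rw [this, map_zero]
  | insert v S hv ih =>
    intro Z hZ hS n hn
    rw [Finset.card_insert_of_notMem hv] at hn
    obtain ⟨m, rfl⟩ : ∃ m, n = m + 1 := ⟨n - 1, by omega⟩
    have hP : IsComplex {E | E ∈ Z ∧ v ∉ E} := fun s hs t ht =>
      ⟨hZ s hs.1 t ht, fun h => hs.2 (ht h)⟩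
    have hQ : IsComplex {E | insert v E ∈ Z} := fun s hs t ht =>
      hZ _ hs _ (Finset.insert_subset_insert _ ht)
    have hU : Z = {E | E ∈ Z ∧ v ∉ E} ∪ {E | insert v E ∈ Z} := by
      ext E
      simp only [Set.mem_union, Set.mem_ofPred_eq]
      constructor
      · intro h
        by_cases hE : v ∈ E
        · right; rwa [Finset.insert_eq_of_mem hE]
        · left; exact ⟨h, hE⟩
      · rintro (h | h)
        · exact h.1
        · exact hZ _ h _ (Finset.subset_insert _ _)
    have hsub : ∀ E ∈ {E | E ∈ Z ∧ v ∉ E}, E ⊆ S := by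
      intro E hE x hx
      have := hS E hE.1 hx
      rw [Finset.mem_insert] at this
      rcases this with rfl | h
      · exact absurd hx hE.2
      · exact h
    rw [hU]
    apply mv3 hP hQ
    · exact ih _ hP hsub _ (by omega)
    · exact van_cone (v := v) (fun E hE => by simpa using hE) _
    · exact ih _ (isComplex_inter hP hQ) (fun E hE => hsub E hE.1) _ (by omega)

/-- Leray property in terms of lists -/
def Ler (X : Set (Finset V)) (a : ℕ) : Prop := ∀ S : Finset V, ∀ n, a < n → Van (induced X S) n

theorem isComplex_induced {X : Set (Finset V)} (hX : IsComplex X) (S : Finset V) :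
    IsComplex (induced X S) := fun s hs t ht => ⟨hX s hs.1 t ht, ht.trans hs.2⟩

theorem van_link {Y : Set (Finset V)} (hY : IsComplex Y) {b : ℕ} (h : Ler Y b) (D : Finset V) :
    ∀ S : Finset V, Disjoint D S → ∀ n, b < n → Van {E | E ⊆ S ∧ E ∪ D ∈ Y} n := by
  induction D using Finset.induction_on with
  | empty =>
    intro S _ n hn
    have := h S n hn
    convert this using 2
    ext E
    simp [induced, and_comm]
  | insert v D hv ih =>
    intro S hS n hn
    rw [Finset.disjoint_insert_left] at hS
    have hP : IsComplex {E | E ⊆ S ∧ E ∪ D ∈ Y} := fun s hs t ht =>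
      ⟨ht.trans hs.1, hY _ hs.2 _ (Finset.union_subset_union_left ht)⟩
    have hQ : IsComplex {E | E ⊆ insert v S ∧ E ∪ insert v D ∈ Y} := fun s hs t ht =>
      ⟨ht.trans hs.1, hY _ hs.2 _ (Finset.union_subset_union_left ht)⟩
    have hI : {E | E ⊆ S ∧ E ∪ insert v D ∈ Y} =
        {E | E ⊆ S ∧ E ∪ D ∈ Y} ∩ {E | E ⊆ insert v S ∧ E ∪ insert v D ∈ Y} := by
      ext E
      simp only [Set.mem_inter_iff, Set.mem_ofPred_eq]
      constructor
      · rintro ⟨h1, h2⟩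
        exact ⟨⟨h1, hY _ h2 _ (Finset.union_subset_union_right (Finset.subset_insert _ _))⟩,
          h1.trans (Finset.subset_insert _ _), h2⟩
      · rintro ⟨⟨h1, h2⟩, h3, h4⟩
        exact ⟨h1, h4⟩
    have hU : {E | E ⊆ S ∧ E ∪ D ∈ Y} ∪ {E | E ⊆ insert v S ∧ E ∪ insert v D ∈ Y} =
        {E | E ⊆ insert v S ∧ E ∪ D ∈ Y} := by
      ext E
      simp only [Set.mem_union, Set.mem_ofPred_eq]
      constructor
      · rintro (⟨h1, h2⟩ | ⟨h1, h2⟩)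
        · exact ⟨h1.trans (Finset.subset_insert _ _), h2⟩
        · exact ⟨h1, hY _ h2 _ (Finset.union_subset_union_right (Finset.subset_insert _ _))⟩
      · rintro ⟨h1, h2⟩
        by_cases hE : v ∈ E
        · right
          refine ⟨h1, ?_⟩
          rwa [Finset.union_insert, Finset.insert_eq_of_mem (Finset.mem_union_left _ hE)]
        · left
          exact ⟨(Finset.subset_insert_iff_of_notMem hE).1 h1, h2⟩
    rw [hI]
    apply mv2 hP hQ
    · rw [hU]
      apply ih
      · rw [Finset.disjoint_insert_right]; exact ⟨hv, hS.2⟩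
      · omega
    · exact ih S hS.2 n hn
    · apply van_cone (v := v)
      rintro E ⟨h1, h2⟩
      refine ⟨Finset.insert_subset (Finset.mem_insert_self _ _) h1, ?_⟩
      rwa [Finset.insert_union, Finset.insert_eq_of_mem]
      simp

/-! Homotopies from vanishing -/

theorem exists_ginv {C : Type*} [AddCommGroup C] [Module ℚ C] (d : C →ₗ[ℚ] C) (S : Submodule ℚ C) :
    ∃ r : C →ₗ[ℚ] C, (∀ x, r x ∈ S) ∧ ∀ x ∈ S, d (r (d x)) = d x := by
  let f : S →ₗ[ℚ] C := d ∘ₗ S.subtype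
  obtain ⟨g, hg⟩ := LinearMap.exists_rightInverse_of_surjective f.rangeRestrict
    (LinearMap.range_rangeRestrict f)
  obtain ⟨g', hg'⟩ := LinearMap.exists_extend g
  refine ⟨S.subtype ∘ₗ g', fun x => (g' x).2, fun x hx => ?_⟩
  have h1 : g' (d x) = g (f.rangeRestrict ⟨x, hx⟩) := by
    rw [← hg']; rfl
  have h2 : f.rangeRestrict (g (f.rangeRestrict ⟨x, hx⟩)) = f.rangeRestrict ⟨x, hx⟩ := by
    rw [← LinearMap.comp_apply, hg]; rfl
  have h3 := congrArg Subtype.val h2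
  simp only [LinearMap.comp_apply, h1]
  exact h3

theorem exists_homotopy {C : Type*} [AddCommGroup C] [Module ℚ C] (d e : C →ₗ[ℚ] C)
    (hdd : ∀ x, d (d x) = 0) (hee : ∀ x, e (e x) = x) (hde : ∀ x, d (e x) = - e (d x))
    (A A' : Submodule ℚ C) (hA : A' ≤ A) (heA : ∀ x ∈ A, e x ∈ A) (heA' : ∀ x ∈ A', e x ∈ A')
    (hex : ∀ x ∈ A', d x = 0 → ∃ w ∈ A, d w = x) :
    ∃ h : C →ₗ[ℚ] C, (∀ x, h x ∈ A) ∧ (∀ x, h (e x) = - e (h x)) ∧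
      ∀ x ∈ A', d (h x) + h (d x) = x := by
  obtain ⟨r, hr, hr'⟩ := exists_ginv d A'
  obtain ⟨s, hs, hs'⟩ := exists_ginv d A
  let k : C →ₗ[ℚ] C := r ∘ₗ d ∘ₗ r + s ∘ₗ (LinearMap.id - r ∘ₗ d) ∘ₗ (LinearMap.id - d ∘ₗ r)
  have hkA : ∀ x, k x ∈ A := fun x => A.add_mem (hA (hr _)) (hs _)
  have hk : ∀ x, k x = r (d (r x)) + s (x - d (r x) - r (d x)) := by
    intro x
    simp [k, hdd]
  have hk' : ∀ x ∈ A', d (k x) + k (d x) = x := by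
    intro x hx
    obtain ⟨w, hw, hdw⟩ := hex (x - r (d x)) (A'.sub_mem hx (hr _))
      (by rw [map_sub, hr' x hx, sub_self])
    have h1 : x - d (r x) - r (d x) = d (w - r x) := by rw [map_sub, hdw]; abel
    rw [hk, hk, map_add, hr' _ (hr x), h1, hs' _ (A.sub_mem hw (hA (hr x))), ← h1, hr' x hx, hdd]
    simp only [sub_self, map_zero, add_zero]
    abel
  refine ⟨(2⁻¹ : ℚ) • (k - e ∘ₗ k ∘ₗ e), ?_, ?_, ?_⟩
  · intro x
    exact A.smul_mem _ (A.sub_mem (hkA _) (heA _ (hkA _)))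
  · intro x
    simp only [LinearMap.smul_apply, LinearMap.sub_apply, LinearMap.comp_apply, hee, map_smul,
      map_sub]
    module
  · intro x hx
    have h2 := hk' x hx
    have h3 : d (e (k (e x))) + e (k (e (d x))) = - x := by
      have h4 := congrArg e (hk' (e x) (heA' x hx))
      rw [hee, map_add, hde x, map_neg, map_neg] at h4
      rw [hde]
      exact (by abel : _ = -(e (d (k (e x))) + -e (k (e (d x))))).trans (congrArg Neg.neg h4)
    simp only [LinearMap.smul_apply, LinearMap.sub_apply, LinearMap.comp_apply, map_smul, map_sub]
    calc _ = (2⁻¹ : ℚ) • ((d (k x) + k (d x)) - (d (e (k (e x))) + e (k (e (d x))))) := by module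
      _ = x := by rw [h2, h3]; module

theorem exists_h {Z : Set (Finset V)} {a : ℕ} (h : ∀ n, a < n → Van Z n) :
    ∃ k : LC V →ₗ[ℚ] LC V, (∀ x, k x ∈ CZ Z) ∧ (∀ x, k (eps x) = - eps (k x)) ∧
      ∀ l : List V, l.toFinset ∈ Z → a < l.length → dd (k (sg l)) + k (dd (sg l)) = sg l := by
  obtain ⟨k, h1, h2, h3⟩ := exists_homotopy (dd : LC V →ₗ[ℚ] LC V) eps dd_dd eps_eps dd_eps (CZ Z)
    (Finsupp.supported ℚ ℚ {l | l.toFinset ∈ Z ∧ a < l.length})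
    (Finsupp.supported_mono (fun _ h => h.1)) (fun _ => eps_CZ) (by
      intro c hc
      have : Finsupp.supported ℚ ℚ {l : List V | l.toFinset ∈ Z ∧ a < l.length} ≤
        (Finsupp.supported ℚ ℚ {l : List V | l.toFinset ∈ Z ∧ a < l.length}).comap eps := by
        apply supp_le
        intro l h1
        rw [Submodule.mem_comap, eps_sg]
        exact Submodule.smul_mem _ _ (sg_mem h1)
      exact this hc) (by
      intro x hx hdx
      have hxZ : x ∈ CZ Z := Finsupp.supported_mono (fun _ h => h.1) hx
      have hpr : ∀ n, ∃ w ∈ CN Z (n + 1), dd w = lproj n x := by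
        intro n
        by_cases hn : a < n
        · apply h n hn _ (lproj_CZ hxZ)
          obtain ⟨m, rfl⟩ : ∃ m, n = m + 1 := ⟨n - 1, by omega⟩
          rw [lproj_dd, hdx, map_zero]
        · refine ⟨0, zero_mem _, ?_⟩
          have : Finsupp.supported ℚ ℚ {l : List V | l.toFinset ∈ Z ∧ a < l.length} ≤
              LinearMap.ker (lproj n) := by
            apply supp_le
            rintro l ⟨h1, h2⟩
            rw [LinearMap.mem_ker, lproj_sg, if_neg (by omega)]
          rw [map_zero, LinearMap.mem_ker.1 (this hx)]
      choose w hw hdw using hpr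
      obtain ⟨N, hN⟩ : ∃ N, ∑ n ∈ Finset.range N, lproj n x = x := by
        clear hx hdx hxZ hdw hw w
        have key : ∃ N, ∀ M ≥ N, ∑ n ∈ Finset.range M, lproj n x = x := by
          induction x using Finsupp.induction_linear with
          | zero => exact ⟨0, by simp⟩
          | add f g hf hg =>
            obtain ⟨N1, h1⟩ := hf
            obtain ⟨N2, h2⟩ := hg
            refine ⟨max N1 N2, fun M hM => ?_⟩
            simp only [map_add, Finset.sum_add_distrib]
            rw [h1 M (le_trans (le_max_left _ _) hM), h2 M (le_trans (le_max_right _ _) hM)]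
          | single l q =>
            refine ⟨l.length + 1, fun M hM => ?_⟩
            have : Finsupp.single l q = q • sg l := by simp [sg]
            rw [this]
            simp only [map_smul, lproj_sg, smul_ite, smul_zero]
            rw [Finset.sum_ite_eq, if_pos (by simp; omega)]
        obtain ⟨N, hN⟩ := key
        exact ⟨N, hN N le_rfl⟩
      refine ⟨∑ n ∈ Finset.range N, w n, Submodule.sum_mem _ fun n _ => CN_le_CZ _ _ (hw n), ?_⟩
      rw [map_sum]
      simp only [hdw, hN])
  exact ⟨k, h1, h2, fun l hl hl' => h3 _ (sg_mem ⟨hl, hl'⟩)⟩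

/-! Tensor products -/

noncomputable def DT : LC V ⊗[ℚ] LC V →ₗ[ℚ] LC V ⊗[ℚ] LC V :=
  TensorProduct.map dd LinearMap.id + TensorProduct.map eps dd

theorem DT_tmul (x y : LC V) : DT (x ⊗ₜ[ℚ] y) = dd x ⊗ₜ y + eps x ⊗ₜ dd y := by
  simp [DT]

noncomputable def cT (D : Finset V) (v : V) : LC V ⊗[ℚ] LC V →ₗ[ℚ] LC V ⊗[ℚ] LC V :=
  if v ∈ D then TensorProduct.map (lcons v) LinearMap.id else TensorProduct.map eps (lcons v)

theorem DT_cT (D : Finset V) (v : V) (t : LC V ⊗[ℚ] LC V) :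
    DT (cT D v t) = t - cT D v (DT t) := by
  induction t using TensorProduct.induction_on with
  | zero => simp
  | add x y hx hy => rw [map_add, map_add, hx, hy, map_add, map_add]; abel
  | tmul x y =>
    unfold cT
    split_ifs
    · simp only [TensorProduct.map_tmul, DT_tmul, map_add, dd_cons, eps_cons, LinearMap.id_apply,
        TensorProduct.sub_tmul, TensorProduct.neg_tmul]
      abel
    · simp only [TensorProduct.map_tmul, DT_tmul, map_add, dd_cons, dd_eps, eps_eps,
        TensorProduct.tmul_sub, TensorProduct.neg_tmul]
      abel

noncomputable def phiL (D : Finset V) : List V → LC V ⊗[ℚ] LC V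
  | [] => sg [] ⊗ₜ sg []
  | v :: l => cT D v (phiL D l)

noncomputable def phi (D : Finset V) : LC V →ₗ[ℚ] LC V ⊗[ℚ] LC V :=
  Finsupp.linearCombination ℚ (phiL D)

theorem phi_sg (D : Finset V) (l : List V) : phi D (sg l) = phiL D l := lin_sg _ _

theorem phi_cons (D : Finset V) (v : V) (c : LC V) : phi D (lcons v c) = cT D v (phi D c) := by
  refine lc_ext_apply (f := phi D ∘ₗ lcons v) (g := cT D v ∘ₗ phi D) ?_ c
  intro l
  simp only [LinearMap.comp_apply, lcons_sg, phi_sg]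
  rfl

theorem DT_phi (D : Finset V) (c : LC V) : DT (phi D c) = phi D (dd c) := by
  refine lc_ext_apply (f := DT ∘ₗ phi D) (g := phi D ∘ₗ dd) ?_ c
  intro l
  induction l with
  | nil => simp [phi_sg, phiL, DT_tmul, dd_nil]
  | cons v l ih =>
    simp only [LinearMap.comp_apply] at ih ⊢
    rw [← lcons_sg, phi_cons, DT_cT, ih, dd_cons, map_sub, phi_cons]

theorem phiL_eq (D : Finset V) (l : List V) : ∃ q : ℚ,
    phiL D l = q • (sg (l.filter (· ∈ D)) ⊗ₜ[ℚ] sg (l.filter (· ∉ D))) := by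
  induction l with
  | nil => exact ⟨1, by simp [phiL]⟩
  | cons v l ih =>
    obtain ⟨q, hq⟩ := ih
    by_cases hv : v ∈ D
    · refine ⟨q, ?_⟩
      simp [phiL, hq, cT, hv, lcons_sg]
    · refine ⟨q * (-1) ^ (l.filter (· ∈ D)).length, ?_⟩
      simp only [phiL, hq, cT, hv, if_false, map_smul, TensorProduct.map_tmul, lcons_sg, eps_sg,
        TensorProduct.smul_tmul', smul_smul]
      simp [hv]

noncomputable def app : LC V →ₗ[ℚ] LC V →ₗ[ℚ] LC V :=
  Finsupp.linearCombination ℚ (fun x => Finsupp.lmapDomain ℚ ℚ (fun y => x ++ y))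

theorem app_sg (x y : List V) : app (sg x) (sg y) = sg (x ++ y) := by
  unfold app
  rw [lin_sg]
  simp [sg, Finsupp.lmapDomain_apply, Finsupp.mapDomain_single]

theorem app_nil (c : LC V) : app (sg []) c = c := by
  refine lc_ext_apply (f := app (sg [])) (g := LinearMap.id) ?_ c
  intro l
  simp [app_sg]

theorem app_cons (v : V) (c e : LC V) : app (lcons v c) e = lcons v (app c e) := by
  have h1 : app ∘ₗ lcons v = (app (V := V)).compr₂ (lcons v) := by
    apply lc_ext
    intro l
    apply lc_ext
    intro m
    simp [lcons_sg, app_sg]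
  exact congrArg (fun f => f c e) h1

noncomputable def psi : LC V ⊗[ℚ] LC V →ₗ[ℚ] LC V := TensorProduct.lift app

theorem psi_tmul (x y : LC V) : psi (x ⊗ₜ[ℚ] y) = app x y := by simp [psi]

theorem psi_DT (t : LC V ⊗[ℚ] LC V) : psi (DT t) = dd (psi t) := by
  induction t using TensorProduct.induction_on with
  | zero => simp
  | add x y hx hy => simp only [map_add, hx, hy]
  | tmul x y =>
    have h1 : (psi ∘ₗ DT) ∘ₗ (TensorProduct.mk ℚ (LC V) (LC V)).flip y =
        (dd ∘ₗ psi) ∘ₗ (TensorProduct.mk ℚ (LC V) (LC V)).flip y := by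
      apply lc_ext
      intro l
      simp only [LinearMap.comp_apply, LinearMap.flip_apply, TensorProduct.mk_apply]
      induction l with
      | nil => simp [DT_tmul, dd_nil, eps_sg, psi_tmul, app_nil]
      | cons v l ih =>
        simp only [DT_tmul, psi_tmul, map_add] at ih ⊢
        rw [← lcons_sg, dd_cons, eps_cons, app_cons, dd_cons, ← ih]
        simp only [map_sub, map_neg, LinearMap.sub_apply, LinearMap.neg_apply, app_cons, map_add]
        abel
    exact congrArg (fun f => f x) h1

/-- the difference `1 - psi phi` -/
noncomputable def gg (D : Finset V) : LC V →ₗ[ℚ] LC V := LinearMap.id - psi ∘ₗ phi D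

theorem gg_apply (D : Finset V) (c : LC V) : gg D c = c - psi (phi D c) := rfl

theorem dd_gg (D : Finset V) (c : LC V) : dd (gg D c) = gg D (dd c) := by
  rw [gg_apply, gg_apply, map_sub, ← psi_DT, DT_phi]

theorem gg_nil (D : Finset V) : gg D (sg []) = 0 := by
  rw [gg_apply, phi_sg, phiL, psi_tmul, app_nil, sub_self]

theorem psi_phi_CZ (D : Finset V) {Z : Set (Finset V)} {c : LC V} (hc : c ∈ CZ Z) :
    psi (phi D c) ∈ CZ Z := by
  have : CZ Z ≤ (CZ Z).comap (psi ∘ₗ phi D) := by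
    apply supp_le
    intro l h1
    rw [Submodule.mem_comap, LinearMap.comp_apply, phi_sg]
    obtain ⟨q, hq⟩ := phiL_eq D l
    rw [hq, map_smul, psi_tmul, app_sg]
    apply Submodule.smul_mem
    apply sg_mem
    have : (l.filter (· ∈ D) ++ l.filter (· ∉ D)).toFinset = l.toFinset := by
      ext x
      simp only [List.mem_toFinset, List.mem_append, List.mem_filter, decide_eq_true_eq]
      tauto
    simp only [Set.mem_ofPred_eq] at h1 ⊢
    rw [this]; exact h1
  exact this hc

noncomputable def hL (D : Finset V) (h : LC V →ₗ[ℚ] LC V) : List V → LC V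
  | [] => 0
  | v :: l => lcons v (gg D (sg (v :: l)) - h (dd (sg (v :: l))))

noncomputable def hh (D : Finset V) : ℕ → (LC V →ₗ[ℚ] LC V)
  | 0 => 0
  | n + 1 => Finsupp.linearCombination ℚ (hL D (hh D n))

theorem hh_succ_sg (D : Finset V) (n : ℕ) (l : List V) :
    hh D (n + 1) (sg l) = hL D (hh D n) l := lin_sg _ _

theorem hh_CZ (D : Finset V) (n : ℕ) : ∀ {Z : Set (Finset V)}, IsComplex Z → ∀ {c : LC V},
    c ∈ CZ Z → hh D n c ∈ CZ Z := by
  induction n with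
  | zero => intro Z _ c _; simp [hh]
  | succ n ih =>
    intro Z hZ c hc
    have : CZ Z ≤ (CZ Z).comap (hh D (n + 1)) := by
      apply supp_le
      intro l h1
      rw [Submodule.mem_comap, hh, lin_sg]
      match l, h1 with
      | [], _ => exact zero_mem _
      | v :: l, h1 =>
        have hW : IsComplex {E | E ⊆ (v :: l).toFinset} := fun s hs t ht => ht.trans hs
        have hm : sg (v :: l) ∈ CZ {E | E ⊆ (v :: l).toFinset} := sg_mem (by simp)
        have h2 : hL D (hh D n) (v :: l) ∈ CZ {E | E ⊆ (v :: l).toFinset} := by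
          apply lcons_CZ (Z := {E | E ⊆ (v :: l).toFinset})
          · intro E hE
            simp only [Set.mem_ofPred_eq] at hE ⊢
            exact Finset.insert_subset (by simp) hE
          · apply Submodule.sub_mem
            · exact Submodule.sub_mem _ hm (psi_phi_CZ D hm)
            · exact ih hW (dd_CZ hW hm)
        exact CZ_mono (fun E hE => hZ _ h1 _ hE) h2
    exact this hc

theorem hh_homotopy (D : Finset V) (n : ℕ) : ∀ {Z : Set (Finset V)} {c : LC V},
    c ∈ CN Z (n + 1) → dd (hh D (n + 1) c) + hh D n (dd c) = gg D c := by
  induction n with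
  | zero =>
    intro Z c hc
    have : CN Z 1 ≤ LinearMap.eqLocus (dd ∘ₗ hh D 1 + hh D 0 ∘ₗ dd) (gg D) := by
      apply supp_le
      rintro l ⟨h1, h2⟩
      match l, h2 with
      | [v], _ =>
        have e : dd (sg [v]) = sg [] := by
          rw [← lcons_sg, dd_cons, dd_nil]; simp
        simp only [LinearMap.mem_eqLocus, LinearMap.add_apply, LinearMap.comp_apply]
        rw [hh_succ_sg, hL, dd_cons, map_sub, dd_gg, e, gg_nil]
        simp [hh]
    exact this hc
  | succ n ih =>
    intro Z c hc
    have : CN Z (n + 1 + 1) ≤ LinearMap.eqLocus (dd ∘ₗ hh D (n + 1 + 1) + hh D (n + 1) ∘ₗ dd)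
        (gg D) := by
      apply supp_le
      rintro l ⟨h1, h2⟩
      have hW : IsComplex {E | E ⊆ l.toFinset} := fun s hs t ht => ht.trans hs
      have hm : sg l ∈ CN {E | E ⊆ l.toFinset} (n + 1 + 1) := sg_mem ⟨by simp, h2⟩
      have key := ih (dd_CN hW hm)
      rw [dd_dd, map_zero, add_zero] at key
      match l, h2 with
      | v :: l, _ =>
        simp only [LinearMap.mem_eqLocus, LinearMap.add_apply, LinearMap.comp_apply]
        rw [hh, lin_sg, hL, dd_cons, map_sub dd, key, dd_gg]
        simp
    exact this hc

/-- Künneth type vanishing for joins. -/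
theorem van_join (D : Finset V) {K L Z : Set (Finset V)} (hZ : IsComplex Z)
    (hKc : IsComplex K) {a b n : ℕ}
    (hK : ∀ n, a < n → Van K n) (hL : ∀ n, b < n → Van L n) (hn : a + b < n)
    (hZ1 : ∀ E ∈ Z, E.filter (· ∈ D) ∈ K ∧ E.filter (· ∉ D) ∈ L)
    (hZ2 : ∀ E ∈ K, ∀ F ∈ L, E ∪ F ∈ Z) : Van Z n := by
  obtain ⟨h, h1, h2, h3⟩ := exists_h hK
  obtain ⟨k, k1, k2, k3⟩ := exists_h hL
  apply van_of_CZ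
  intro z hz hdz
  obtain ⟨m, rfl⟩ : ∃ m, n = m + 1 := ⟨n - 1, by omega⟩
  have e1 := hh_homotopy D m hz
  rw [hdz, map_zero, add_zero, gg_apply] at e1
  let T : Submodule ℚ (LC V ⊗[ℚ] LC V) :=
    Submodule.map₂ (TensorProduct.mk ℚ (LC V) (LC V)) (CZ K) (CZ L)
  let p : LC V →ₗ[ℚ] LC V := LinearMap.id - dd ∘ₗ h - h ∘ₗ dd
  let q : LC V →ₗ[ℚ] LC V := LinearMap.id - dd ∘ₗ k - k ∘ₗ dd
  let HA : LC V ⊗[ℚ] LC V →ₗ[ℚ] LC V ⊗[ℚ] LC V := TensorProduct.map h LinearMap.id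
  let HB : LC V ⊗[ℚ] LC V →ₗ[ℚ] LC V ⊗[ℚ] LC V := TensorProduct.map (eps ∘ₗ p) k
  have hA : ∀ t, t - TensorProduct.map p LinearMap.id t = DT (HA t) + HA (DT t) := by
    intro t
    induction t using TensorProduct.induction_on with
    | zero => simp
    | add x y hx hy =>
      simp only [map_add]
      rw [add_sub_add_comm, hx, hy]; abel
    | tmul x y =>
      simp only [HA, p, DT_tmul, TensorProduct.map_tmul, map_add, LinearMap.id_apply,
        LinearMap.sub_apply, LinearMap.comp_apply, TensorProduct.sub_tmul, h2,
        TensorProduct.neg_tmul]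
      abel
  have hpd : ∀ x, dd (p x) = p (dd x) := by
    intro x
    simp [p, dd_dd]
  have hpe : ∀ x, eps (p x) = p (eps x) := by
    intro x
    simp [p, dd_eps, h2]
  have hB : ∀ t, TensorProduct.map p LinearMap.id t - TensorProduct.map p q t =
      DT (HB t) + HB (DT t) := by
    intro t
    induction t using TensorProduct.induction_on with
    | zero => simp
    | add x y hx hy =>
      simp only [map_add]
      rw [add_sub_add_comm, hx, hy]; abel
    | tmul x y =>
      simp only [HB, DT_tmul, TensorProduct.map_tmul, map_add, LinearMap.id_apply,
        LinearMap.comp_apply, ← hpe, ← hpd, eps_eps, dd_eps, TensorProduct.neg_tmul]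
      simp only [q, LinearMap.id_apply,
        LinearMap.sub_apply, LinearMap.comp_apply, TensorProduct.tmul_sub]
      abel
  have hkill : TensorProduct.map p q (phi D z) = 0 := by
    have : CN Z (m + 1) ≤ LinearMap.ker (TensorProduct.map p q ∘ₗ phi D) := by
      apply supp_le
      rintro l ⟨l1, l2⟩
      rw [LinearMap.mem_ker, LinearMap.comp_apply, phi_sg]
      obtain ⟨c, hc⟩ := phiL_eq D l
      rw [hc, map_smul, TensorProduct.map_tmul]
      have hlen : (l.filter (· ∈ D)).length + (l.filter (· ∉ D)).length = m + 1 := by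
        rw [← l2, List.length_eq_length_filter_add (l := l) (fun x => decide (x ∈ D))]
        congr 2
        simp
      have hl := hZ1 _ l1
      have t1 : (l.filter (· ∈ D)).toFinset = l.toFinset.filter (· ∈ D) := by ext; simp
      have t2 : (l.filter (· ∉ D)).toFinset = l.toFinset.filter (· ∉ D) := by ext; simp
      by_cases ha : a < (l.filter (· ∈ D)).length
      · have : p (sg (l.filter (· ∈ D))) = 0 := by
          have := h3 _ (t1 ▸ hl.1) ha
          simp only [p, LinearMap.sub_apply, LinearMap.id_apply, LinearMap.comp_apply]
          rw [sub_sub, this, sub_self]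
        rw [this]; simp
      · have : q (sg (l.filter (· ∉ D))) = 0 := by
          have := k3 _ (t2 ▸ hl.2) (by omega)
          simp only [q, LinearMap.sub_apply, LinearMap.id_apply, LinearMap.comp_apply]
          rw [sub_sub, this, sub_self]
        rw [this]; simp
    exact this hz
  have hcyc : DT (phi D z) = 0 := by rw [DT_phi, hdz, map_zero]
  have e2 : phi D z = DT (HA (phi D z) + HB (phi D z)) := by
    have a1 := hA (phi D z)
    have a2 := hB (phi D z)
    rw [hcyc, map_zero, add_zero] at a1 a2
    rw [hkill, sub_zero] at a2
    rw [map_add, ← a1, ← a2]; abel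
  have hphiT : phi D z ∈ T := by
    have : CN Z (m + 1) ≤ T.comap (phi D) := by
      apply supp_le
      rintro l ⟨l1, l2⟩
      rw [Submodule.mem_comap, phi_sg]
      obtain ⟨c, hc⟩ := phiL_eq D l
      rw [hc]
      have hl := hZ1 _ l1
      have t1 : (l.filter (· ∈ D)).toFinset = l.toFinset.filter (· ∈ D) := by ext; simp
      have t2 : (l.filter (· ∉ D)).toFinset = l.toFinset.filter (· ∉ D) := by ext; simp
      exact Submodule.smul_mem _ _ (Submodule.apply_mem_map₂ _ (sg_mem (by
        rw [Set.mem_ofPred_eq, t1]; exact hl.1)) (sg_mem (by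
        rw [Set.mem_ofPred_eq, t2]; exact hl.2)))
    exact this hz
  have hHA : T ≤ T.comap HA := by
    apply Submodule.map₂_le.2
    intro x hx y hy
    exact Submodule.apply_mem_map₂ _ (h1 _) hy
  have hHB : T ≤ T.comap HB := by
    apply Submodule.map₂_le.2
    intro x hx y hy
    refine Submodule.apply_mem_map₂ _ (eps_CZ ?_) (k1 _)
    exact Submodule.sub_mem _ (Submodule.sub_mem _ hx (dd_CZ hKc (h1 _))) (h1 _)
  have hps : T ≤ (CZ Z).comap psi := by
    apply Submodule.map₂_le.2
    intro x hx y hy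
    have c1 : CZ K ≤ (CZ Z).comap (app.flip y) := by
      apply supp_le
      intro l hl
      have c2 : CZ L ≤ (CZ Z).comap (app (sg l)) := by
        apply supp_le
        intro l' hl'
        rw [Submodule.mem_comap, app_sg]
        apply sg_mem
        rw [Set.mem_ofPred_eq, List.toFinset_append]
        exact hZ2 _ hl _ hl'
      exact c2 hy
    rw [Submodule.mem_comap, TensorProduct.mk_apply, psi_tmul]
    exact c1 hx
  refine ⟨hh D (m + 1) z + psi (HA (phi D z) + HB (phi D z)), ?_, ?_⟩
  · exact Submodule.add_mem _ (hh_CZ D _ hZ (CN_le_CZ _ _ hz))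
      (hps (Submodule.add_mem _ (hHA hphiT) (hHB hphiT)))
  · rw [map_add, ← psi_DT, ← e2, e1]; abel

theorem van_inter_aux [Fintype V] {X Y : Set (Finset V)} (hX : IsComplex X) (hY : IsComplex Y)
    {a b n : ℕ} (ha : Ler X a) (hb : Ler Y b) (hn : a + b < n) (W : Finset V) :
    ∀ D F : Finset V, Disjoint D F → D ∪ F ∪ W = Finset.univ →
      Van {E | E \ F ∈ X ∧ E ∪ D ∈ Y} n := by
  have hc : ∀ D F : Finset V, IsComplex {E | E \ F ∈ X ∧ E ∪ D ∈ Y} := fun D F s hs t ht =>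
    ⟨hX _ hs.1 _ (Finset.sdiff_subset_sdiff ht le_rfl),
      hY _ hs.2 _ (Finset.union_subset_union_left ht)⟩
  induction W using Finset.induction_on with
  | empty =>
    intro D F hD hU
    have hF : ∀ x, x ∈ F ↔ x ∉ D := by
      intro x
      have := Finset.mem_univ x
      rw [← hU] at this
      have h2 : x ∈ D → x ∉ F := fun h => Finset.disjoint_left.1 hD h
      simp at this
      tauto
    refine van_join D (K := induced X D) (L := {E | E ⊆ F ∧ E ∪ D ∈ Y}) (hc D F)
      (isComplex_induced hX D) (ha D) (van_link hY hb D F hD) hn ?_ ?_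
    · rintro E ⟨h1, h2⟩
      refine ⟨⟨?_, ?_⟩, ?_, ?_⟩
      · refine hX _ h1 _ ?_
        intro x hx
        simp [hF] at hx ⊢
        exact hx
      · intro x hx
        simp at hx
        exact hx.2
      · intro x hx
        rw [Finset.mem_filter] at hx
        exact (hF x).2 hx.2
      · exact hY _ h2 _ (Finset.union_subset_union_left (Finset.filter_subset _ _))
    · rintro E ⟨h1, h2⟩ G ⟨h3, h4⟩
      refine ⟨hX _ h1 _ ?_, hY _ h4 _ ?_⟩
      · intro x hx
        simp only [Finset.mem_sdiff, Finset.mem_union] at hx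
        have := @h3 x
        tauto
      · intro x hx
        simp only [Finset.mem_union] at hx ⊢
        have := @h2 x
        tauto
  | insert v W hv ih =>
    intro D F hD hU
    by_cases hvDF : v ∈ D ∪ F
    · apply ih D F hD
      rw [← hU, Finset.union_insert, Finset.insert_eq_of_mem (Finset.mem_union_left _ hvDF)]
    · rw [Finset.mem_union, not_or] at hvDF
      apply mv1 (Q := {E | E \ (insert v F) ∈ X ∧ E ∪ (insert v D) ∈ Y}) (hc D F) (hc _ _)
      · have := ih D (insert v F) (Finset.disjoint_insert_right.2 ⟨hvDF.1, hD⟩) (by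
          rw [← hU]; ext; simp only [Finset.mem_union, Finset.mem_insert]; tauto)
        convert this using 2
        ext E
        simp only [Set.mem_union, Set.mem_ofPred_eq]
        constructor
        · rintro (⟨h1, h2⟩ | ⟨h1, h2⟩)
          · exact ⟨hX _ h1 _ (Finset.sdiff_subset_sdiff le_rfl (Finset.subset_insert _ _)), h2⟩
          · exact ⟨h1, hY _ h2 _ (Finset.union_subset_union_right (Finset.subset_insert _ _))⟩
        · rintro ⟨h1, h2⟩
          by_cases hE : v ∈ E
          · right
            refine ⟨h1, ?_⟩
            rwa [Finset.union_insert, Finset.insert_eq_of_mem (Finset.mem_union_left _ hE)]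
          · left
            refine ⟨?_, h2⟩
            rwa [Finset.sdiff_insert_of_notMem hE] at h1
      · have := ih (insert v D) F (Finset.disjoint_insert_left.2 ⟨hvDF.2, hD⟩) (by
          rw [← hU]; ext; simp only [Finset.mem_union, Finset.mem_insert]; tauto)
        convert this using 2
        ext E
        simp only [Set.mem_inter_iff, Set.mem_ofPred_eq]
        constructor
        · rintro ⟨⟨h1, h2⟩, ⟨h3, h4⟩⟩
          exact ⟨h1, h4⟩
        · rintro ⟨h1, h2⟩
          exact ⟨⟨h1, hY _ h2 _ (Finset.union_subset_union_right (Finset.subset_insert _ _))⟩,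
            hX _ h1 _ (Finset.sdiff_subset_sdiff le_rfl (Finset.subset_insert _ _)), h2⟩

theorem ler_induced {X : Set (Finset V)} {a : ℕ} (h : Ler X a) (S : Finset V) :
    Ler (induced X S) a := by
  intro T n hn
  have := h (S ∩ T) n hn
  have e : induced (induced X S) T = induced X (S ∩ T) := by
    ext E
    simp [induced, Finset.subset_inter_iff, and_assoc]
  rw [e]; exact this

theorem ler_inter [Fintype V] {X Y : Set (Finset V)} (hX : IsComplex X) (hY : IsComplex Y)
    {a b : ℕ} (ha : Ler X a) (hb : Ler Y b) : Ler (X ∩ Y) (a + b) := by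
  intro S n hn
  have := van_inter_aux (isComplex_induced hX S) (isComplex_induced hY S) (ler_induced ha S)
    (ler_induced hb S) hn Finset.univ ∅ ∅ (by simp) (by simp)
  have e : induced (X ∩ Y) S =
      {E | E \ ∅ ∈ induced X S ∧ E ∪ ∅ ∈ induced Y S} := by
    ext E
    simp only [induced, Set.mem_ofPred_eq, Finset.sdiff_empty, Finset.union_empty,
      Set.mem_inter_iff]
    tauto
  rw [e]; exact this

theorem ler_univ : Ler (Set.univ : Set (Finset V)) 0 := by
  intro S n hn
  rcases S.eq_empty_or_nonempty with rfl | ⟨v, hv⟩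
  · exact van_large ∅ _ (isComplex_induced (fun _ _ _ _ => trivial) _) (fun E hE => hE.2) n
      (by simpa using hn)
  · exact van_cone (v := v) (Z := induced Set.univ S)
      (fun E hE => ⟨trivial, Finset.insert_subset hv hE.2⟩) n

/-! Comparison with the frozen definitions -/

theorem toFinset_ofFn' {n : ℕ} (τ : Fin n → V) :
    (List.ofFn τ).toFinset = Finset.image τ Finset.univ := by
  ext x
  simp [List.mem_ofFn]

theorem dd_ofFn {n : ℕ} (σ : Fin (n + 1) → V) : dd (sg (List.ofFn σ)) =
    ∑ i : Fin (n + 1), ((-1 : ℚ) ^ (i : ℕ)) • sg (List.ofFn (σ ∘ i.succAbove)) := by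
  induction n with
  | zero =>
    rw [List.ofFn_succ, ← lcons_sg, dd_cons]
    simp [dd_nil]
  | succ n ih =>
    rw [List.ofFn_succ, ← lcons_sg, dd_cons, ih,
      Fin.sum_univ_succ (n := n + 1), sub_eq_add_neg, map_sum,
      ← Finset.sum_neg_distrib]
    congr 1
    · simp [Function.comp_def]
    · apply Finset.sum_congr rfl
      intro i _
      rw [map_smul, lcons_sg, ← neg_smul, List.ofFn_succ (f := σ ∘ i.succ.succAbove)]
      simp [Function.comp_def, pow_succ]

noncomputable def jn (X : Set (Finset V)) (n : ℕ) : Chains X n →ₗ[ℚ] LC V :=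
  Finsupp.lmapDomain ℚ ℚ (fun σ : Tup X n => List.ofFn σ.1)

theorem jn_inj (X : Set (Finset V)) (n : ℕ) : Function.Injective (jn X n) := by
  apply Finsupp.mapDomain_injective
  intro σ τ h
  exact Subtype.ext (List.ofFn_injective h)

theorem jn_range (X : Set (Finset V)) (n : ℕ) : LinearMap.range (jn X n) = CN X n := by
  unfold jn CN
  rw [Finsupp.range_lmapDomain, Finsupp.supported_eq_span_single]
  congr 1
  ext c
  constructor
  · rintro ⟨σ, rfl⟩
    refine ⟨List.ofFn σ.1, ⟨?_, by simp⟩, rfl⟩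
    rw [toFinset_ofFn']; exact σ.2
  · rintro ⟨l, ⟨h1, h2⟩, rfl⟩
    subst h2
    refine ⟨⟨l.get, ?_⟩, ?_⟩
    · rw [← toFinset_ofFn', List.ofFn_get]; exact h1
    · simp

theorem jn_gen (X : Set (Finset V)) {n : ℕ} (τ : Fin n → V)
    (h : Finset.image τ Finset.univ ∈ X) : jn X n (gen X τ) = sg (List.ofFn τ) := by
  rw [gen, dif_pos h]
  exact Finsupp.mapDomain_single

theorem jn_bdry {X : Set (Finset V)} (hX : IsComplex X) (n : ℕ) (c : Chains X (n + 1)) :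
    jn X n (bdry X n c) = dd (jn X (n + 1) c) := by
  have : jn X n ∘ₗ bdry X n = dd ∘ₗ jn X (n + 1) := by
    apply Finsupp.lhom_ext'
    intro σ
    ext1
    have e : jn X (n + 1) (Finsupp.single σ 1) = sg (List.ofFn σ.1) := by
      simp [jn, sg, Finsupp.lmapDomain_apply, Finsupp.mapDomain_single]
    simp only [LinearMap.comp_apply, Finsupp.lsingle_apply, e, dd_ofFn]
    have e2 : bdry X n (Finsupp.single σ 1) =
        ∑ i : Fin (n + 1), ((-1 : ℚ) ^ (i : ℕ)) • gen X (σ.1 ∘ i.succAbove) := by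
      simp [bdry]
    rw [e2, map_sum]
    apply Finset.sum_congr rfl
    intro i _
    rw [map_smul, jn_gen]
    apply hX _ σ.2
    intro x hx
    simp only [Finset.mem_image, Finset.mem_univ, true_and, Function.comp_apply] at hx ⊢
    obtain ⟨y, hy⟩ := hx
    exact ⟨_, hy⟩
  exact congrArg (fun f => f c) this

theorem vanishes_iff {X : Set (Finset V)} (hX : IsComplex X) (i : ℕ) :
    HomologyVanishes X i ↔ Van X (i + 1) := by
  have h0 : HomologyVanishes X i ↔ ∀ z, bdry X i z = 0 → ∃ w, bdry X (i + 1) w = z := by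
    constructor
    · intro h z hz
      have := h (Submodule.Quotient.mk ⟨z, hz⟩)
      rw [Submodule.Quotient.mk_eq_zero] at this
      exact this
    · intro h x
      obtain ⟨⟨z, hz⟩, rfl⟩ := Submodule.Quotient.mk_surjective _ x
      rw [Submodule.Quotient.mk_eq_zero]
      exact h z hz
  rw [h0]
  constructor
  · intro h z hz hdz
    rw [← jn_range] at hz
    obtain ⟨z, rfl⟩ := hz
    rw [← jn_bdry hX] at hdz
    obtain ⟨w, rfl⟩ := h z (jn_inj X i (by rw [hdz, map_zero]))
    refine ⟨jn X _ w, ?_, (jn_bdry hX _ _).symm⟩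
    rw [← jn_range]; exact ⟨w, rfl⟩
  · intro h z hz
    obtain ⟨w, hw, hdw⟩ := h (jn X _ z) (by rw [← jn_range]; exact ⟨z, rfl⟩)
      (by rw [← jn_bdry hX, hz, map_zero])
    rw [← jn_range] at hw
    obtain ⟨w, rfl⟩ := hw
    exact ⟨w, jn_inj X _ (by rw [jn_bdry hX, hdw])⟩

theorem ler_iff {X : Set (Finset V)} (hX : IsComplex X) (d : ℕ) :
    Ler X d ↔ ∀ S : Finset V, ∀ i, d ≤ i → HomologyVanishes (induced X S) i := by
  constructor
  · intro h S i hi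
    rw [vanishes_iff (isComplex_induced hX S)]
    exact h S _ (by omega)
  · intro h S n hn
    obtain ⟨m, rfl⟩ : ∃ m, n = m + 1 := ⟨n - 1, by omega⟩
    rw [← vanishes_iff (isComplex_induced hX S)]
    exact h S _ (by omega)

theorem ler_lerayNumber [Fintype V] {X : Set (Finset V)} (hX : IsComplex X) :
    Ler X (lerayNumber X) := by
  rw [ler_iff hX]
  apply Nat.sInf_mem (s := {d | ∀ S : Finset V, ∀ i, d ≤ i → HomologyVanishes (induced X S) i})
  refine ⟨Fintype.card V, ?_⟩
  rw [Set.mem_ofPred_eq, ← ler_iff hX]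
  intro S n hn
  exact van_large Finset.univ _ (isComplex_induced hX S) (fun E _ => Finset.subset_univ E) n hn

theorem isComplex_biInter {ι : Type*} (X : ι → Set (Finset V)) (hX : ∀ j, IsComplex (X j))
    (s : Finset ι) : IsComplex (⋂ j ∈ s, X j) := by
  intro E hE F hF
  simp only [Set.mem_iInter] at hE ⊢
  exact fun j hj => hX j _ (hE j hj) _ hF

theorem ler_biInter [Fintype V] {ι : Type*} (X : ι → Set (Finset V))
    (hX : ∀ j, IsComplex (X j)) (s : Finset ι) :
    Ler (⋂ j ∈ s, X j) (∑ j ∈ s, lerayNumber (X j)) := by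
  classical
  induction s using Finset.induction_on with
  | empty => simpa using ler_univ
  | insert j s hj ih =>
    rw [Finset.sum_insert hj, Finset.set_biInter_insert]
    exact ler_inter (hX j) (isComplex_biInter X hX s) (ler_lerayNumber (hX j)) ih

end LerayAux

/-- `L(⋂ X_j) ≤ Σ L(X_j)` for complexes on a common finite vertex set. -/
theorem stmt2 {V : Type*} [DecidableEq V] [Fintype V] {k : ℕ}
    (X : Fin k → Set (Finset V)) (hX : ∀ j, IsComplex (X j)) :
    lerayNumber (⋂ j, X j) ≤ ∑ j, lerayNumber (X j) := by
  have h := ler_biInter X hX Finset.univ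
  have hc := isComplex_biInter X hX Finset.univ
  simp only [Finset.mem_univ, Set.iInter_true] at h hc
  exact Nat.sInf_le ((ler_iff hc _).1 h)
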